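/- arXiv:1810.04899 — 4 statements merged into one kernel-verified Lean document; each statement's English description precedes it below -/
import Mathlib

section
/- Suppose the ℤ-graded vertex algebra V = ⊕_{n∈ℤ} V_n admits a second decomposition V = ⊕_{n∈ℤ} V'_n making V a ℤ-graded vertex algebra. If V'_n ⊆ V_{≥n} for all n ∈ ℤ, then there exists a vertex algebra homomorphism ψ : V → V such that ψ(V'_n) ⊆ V_n for all n ∈ ℤ. If moreover V_n ⊆ V'_{≥n} for all n ∈ ℤ (where V'_{≥n} = ⊕_{i≥n} V'_i), then there exists ψ ∈ Aut⁺V such that ψ(V_n) = V'_n for all n ∈ ℤ. -/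
/-!
Common framework: vertex algebras, ℤ-graded (conformal) vertex algebras,
conformal vectors, automorphism groups, following Moriwaki,
"On classification of conformal vectors in vertex operator algebra and
the vertex algebra automorphism group".
-/

noncomputable section

open scoped BigOperators

/-- The generalized binomial coefficient `binom(m, i)` for `m : ℤ`, valued in a field `K`. -/
def zBinom (K : Type*) [Field K] (m : ℤ) (i : ℕ) : K :=
  (∏ j ∈ Finset.range i, ((m : K) - (j : K))) / (Nat.factorial i : K)

/-- A vertex algebra over a field `K`: a `K`-vector space `V` equipped with bilinear
`n`-th products `a(n)b` (`n : ℤ`) and a vacuum vector `𝟙`, subject to the truncation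
condition, the vacuum and creation axioms, and the Borcherds identity. -/
structure VA (K V : Type*) [Field K] [AddCommGroup V] [Module K V] where
  /-- the `n`-th product `a(n)b`, bilinear in `a` and `b` -/
  ncoef : ℤ → V →ₗ[K] V →ₗ[K] V
  /-- the vacuum vector `𝟙` -/
  vac : V
  /-- truncation: `a(n)b = 0` for `n` sufficiently large -/
  trunc : ∀ a b : V, ∃ N : ℤ, ∀ n : ℤ, N ≤ n → ncoef n a b = 0
  /-- the vacuum axiom `Y(𝟙, z) = id`, i.e. `𝟙(n)a = δ_{n,-1} a` -/
  vac_ncoef : ∀ (n : ℤ) (a : V), ncoef n vac a = if n = -1 then a else 0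
  /-- creation: `a(-1)𝟙 = a` -/
  ncoef_vac : ∀ a : V, ncoef (-1) a vac = a
  /-- creation: `a(n)𝟙 = 0` for `n ≥ 0` -/
  ncoef_vac_zero : ∀ n : ℤ, 0 ≤ n → ∀ a : V, ncoef n a vac = 0
  /-- the Borcherds identity -/
  borcherds : ∀ (a b c : V) (p q m : ℤ),
    (∑ᶠ i : ℕ, zBinom K m i •
        ncoef (m + q - (i : ℤ)) (ncoef (p + (i : ℤ)) a b) c)
      = ∑ᶠ i : ℕ, ((-1 : K) ^ i * zBinom K p i) •
          (ncoef (m + p - (i : ℤ)) a (ncoef (q + (i : ℤ)) b c)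
            - ((p.negOnePow : ℤ) : K) •
                ncoef (p + q - (i : ℤ)) b (ncoef (m + (i : ℤ)) a c))

namespace VA

variable {K V : Type*} [Field K] [AddCommGroup V] [Module K V]

/-- The translation operator `T a = a(-2)𝟙`. -/
def T (A : VA K V) : V →ₗ[K] V := (A.ncoef (-2)).flip A.vac

/-- The eigenspace `V_n^a = {v ∈ V | a(1)v = n v}` of `a(1)`. -/
def eig (A : VA K V) (a : V) (n : ℤ) : Submodule K V :=
  LinearMap.ker (A.ncoef 1 a - (n : K) • (LinearMap.id : V →ₗ[K] V))

/-- `a` is a conformal vector: `a(1)a = 2a`, `a(3)a ∈ K𝟙`, `a(2)a = 0`, `a(n)a = 0`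
for `n ≥ 4`, `a(0) = T`, and `a(1)` is semisimple with integer eigenvalues
(`V = ⊕_{n ∈ ℤ} V_n^a`). -/
def IsConformal (A : VA K V) (a : V) : Prop :=
  A.ncoef 1 a a = (2 : K) • a ∧
  (∃ c : K, A.ncoef 3 a a = c • A.vac) ∧
  A.ncoef 2 a a = 0 ∧
  (∀ n : ℤ, 4 ≤ n → A.ncoef n a a = 0) ∧
  A.ncoef 0 a = A.T ∧
  DirectSum.IsInternal (A.eig a)

/-- `a` is a conformal vector of CFT type: `(V, a)` is a VOA of CFT type, i.e.
`V = ⊕_{n ∈ ℕ} V_n^a` with finite-dimensional pieces and `V_0^a = K𝟙`. -/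
def IsConformalCFT (A : VA K V) (a : V) : Prop :=
  A.IsConformal a ∧
  (∀ n : ℤ, n < 0 → A.eig a n = ⊥) ∧
  (∀ n : ℤ, FiniteDimensional K (A.eig a n)) ∧
  A.eig a 0 = Submodule.span K {A.vac}

/-- `a` is a conformal vector of strong CFT type: of CFT type and `a(2)V_1^a = 0`
(i.e. `L^a(1) V_1^a = 0`). -/
def IsConformalSCFT (A : VA K V) (a : V) : Prop :=
  A.IsConformalCFT a ∧ ∀ v ∈ A.eig a 1, A.ncoef 2 a v = 0

/-- A vertex algebra homomorphism: a linear map preserving all products and the vacuum. -/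
structure IsVAHom (A : VA K V) (f : V → V) : Prop where
  map_add : ∀ a b : V, f (a + b) = f a + f b
  map_smul : ∀ (c : K) (a : V), f (c • a) = c • f a
  map_ncoef : ∀ (n : ℤ) (a b : V), f (A.ncoef n a b) = A.ncoef n (f a) (f b)
  map_vac : f A.vac = A.vac

/-- A vertex algebra automorphism: a bijective vertex algebra homomorphism. -/
def IsVAAut (A : VA K V) (f : V → V) : Prop :=
  A.IsVAHom f ∧ Function.Bijective f

/-- A (two-sided) ideal of a vertex algebra. -/
def IsIdeal (A : VA K V) (I : Submodule K V) : Prop :=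
  ∀ (n : ℤ) (a : V), ∀ b ∈ I, A.ncoef n a b ∈ I ∧ A.ncoef n b a ∈ I

/-- A vertex algebra is simple if it has no ideals other than `0` and itself. -/
def IsSimple (A : VA K V) : Prop :=
  ∀ I : Submodule K V, A.IsIdeal I → I = ⊥ ∨ I = ⊤

end VA

/-- The exponential `exp f = Σ_{n≥0} f^n / n!` of an endomorphism, as a function
(meaningful for locally nilpotent `f`). -/
def expOp {K V : Type*} [Field K] [AddCommGroup V] [Module K V]
    (f : V →ₗ[K] V) (v : V) : V :=
  ∑ᶠ n : ℕ, (Nat.factorial n : K)⁻¹ • (f ^ n) v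

/-- A ℤ-grading on a vertex algebra, making it a ℤ-graded vertex algebra:
`V = ⊕_{n ∈ ℤ} V_n`, `V_n(k)V_m ⊆ V_{n+m-k-1}` and `𝟙 ∈ V_0`. -/
structure GradedVA {K V : Type*} [Field K] [AddCommGroup V] [Module K V] (A : VA K V) where
  /-- the grading subspaces `V_n` -/
  gr : ℤ → Submodule K V
  /-- `V = ⊕_{n ∈ ℤ} V_n` -/
  decomp : DirectSum.Decomposition gr
  /-- `𝟙 ∈ V_0` -/
  vac_mem : A.vac ∈ gr 0
  /-- `V_n(k)V_m ⊆ V_{n+m-k-1}` -/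
  ncoef_mem : ∀ (n m k : ℤ), ∀ a ∈ gr n, ∀ b ∈ gr m, A.ncoef k a b ∈ gr (n + m - k - 1)

namespace GradedVA

variable {K V : Type*} [Field K] [AddCommGroup V] [Module K V] {A : VA K V}

/-- The canonical projection `pr_n : V → V_n`. -/
def pr (G : GradedVA A) (n : ℤ) (v : V) : V :=
  letI := G.decomp
  (DirectSum.decompose G.gr v n : V)

/-- `V_{≥n} = ⊕_{i ≥ n} V_i`. -/
def ge (G : GradedVA A) (n : ℤ) : Submodule K V := ⨆ i ≥ n, G.gr i

/-- `V_{≤n} = ⊕_{i ≤ n} V_i`. -/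
def le (G : GradedVA A) (n : ℤ) : Submodule K V := ⨆ i ≤ n, G.gr i

/-- `J_1(V) = {a ∈ V_1 | a(0) = 0}`. -/
def J1 (G : GradedVA A) : Set V :=
  {a : V | a ∈ G.gr 1 ∧ A.ncoef 0 a = 0}

/-- `Aut⁺V`: automorphisms `f` with `f(V_n) ⊆ V_{≥n}` and `pr_n ∘ f|_{V_n} = id`. -/
def AutPlus (G : GradedVA A) (f : V → V) : Prop :=
  A.IsVAAut f ∧ ∀ n : ℤ, ∀ v ∈ G.gr n, f v ∈ G.ge n ∧ G.pr n (f v) = v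

/-- `Aut⁻V`: automorphisms `f` with `f(V_n) ⊆ ⊕_{k ≤ n} V_k` and `pr_n ∘ f|_{V_n} = id`. -/
def AutMinus (G : GradedVA A) (f : V → V) : Prop :=
  A.IsVAAut f ∧ ∀ n : ℤ, ∀ v ∈ G.gr n, f v ∈ G.le n ∧ G.pr n (f v) = v

/-- `Aut⁰V`: automorphisms `f` with `f(V_n) ⊆ V_n`. -/
def AutZero (G : GradedVA A) (f : V → V) : Prop :=
  A.IsVAAut f ∧ ∀ n : ℤ, ∀ v ∈ G.gr n, f v ∈ G.gr n

end GradedVA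

/-- A ℤ-graded conformal vertex algebra: a ℤ-graded vertex algebra with a conformal
vector `ω ∈ V_2` whose modes `L(n) = ω(n+1)` satisfy the Virasoro relations, with
`L(0)v = n v` for `v ∈ V_n` and `L(-1) = T`. -/
structure ConfGVA {K V : Type*} [Field K] [AddCommGroup V] [Module K V] (A : VA K V)
    extends GradedVA A where
  /-- the conformal vector -/
  ω : V
  ω_mem : ω ∈ gr 2
  /-- the Virasoro relations `[L(n), L(m)] = (n-m)L(n+m) + δ_{n+m,0}((n³-n)/12)c` -/
  virasoro : ∃ c : K, ∀ n m : ℤ,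
    A.ncoef (n + 1) ω ∘ₗ A.ncoef (m + 1) ω - A.ncoef (m + 1) ω ∘ₗ A.ncoef (n + 1) ω
      = ((n : K) - (m : K)) • A.ncoef (n + m + 1) ω
        + (if n + m = 0 then ((n : K) ^ 3 - (n : K)) / 12 * c else 0)
            • (LinearMap.id : V →ₗ[K] V)
  /-- `L(0) v = n v` for `v ∈ V_n` -/
  L0_grading : ∀ n : ℤ, ∀ v ∈ gr n, A.ncoef 1 ω v = (n : K) • v
  /-- `L(-1) = T` -/
  Lneg1_eq_T : A.ncoef 0 ω = A.T

namespace ConfGVA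

variable {K V : Type*} [Field K] [AddCommGroup V] [Module K V] {A : VA K V}

abbrev pr (C : ConfGVA A) : ℤ → V → V := C.toGradedVA.pr
abbrev ge (C : ConfGVA A) : ℤ → Submodule K V := C.toGradedVA.ge
abbrev le (C : ConfGVA A) : ℤ → Submodule K V := C.toGradedVA.le
abbrev J1 (C : ConfGVA A) : Set V := C.toGradedVA.J1
abbrev AutPlus (C : ConfGVA A) : (V → V) → Prop := C.toGradedVA.AutPlus
abbrev AutMinus (C : ConfGVA A) : (V → V) → Prop := C.toGradedVA.AutMinus
abbrev AutZero (C : ConfGVA A) : (V → V) → Prop := C.toGradedVA.AutZero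

/-- `Aut_ω V`: the VOA automorphisms, i.e. the stabilizer of `ω` in `Aut V`. -/
def AutOmega (C : ConfGVA A) (f : V → V) : Prop :=
  A.IsVAAut f ∧ f C.ω = C.ω

/-- An invariant bilinear form on `(V, ω)`:
`(a(n)b, c) = (-1)^d Σ_{j≥0} (1/j!) (b, (L(1)^j a)(2d-n-2-j) c)` for `a ∈ V_d`, which is the
coefficient form of `(Y(a,z)b, c) = (b, Y(e^{zL(1)}(-z^{-2})^{L(0)} a, z^{-1}) c)`. -/
def IsInvForm (C : ConfGVA A) (B : V →ₗ[K] V →ₗ[K] K) : Prop :=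
  ∀ d : ℤ, ∀ a ∈ C.gr d, ∀ (b c : V) (n : ℤ),
    B (A.ncoef n a b) c
      = ((d.negOnePow : ℤ) : K) *
          ∑ᶠ j : ℕ, (Nat.factorial j : K)⁻¹ *
            B b (A.ncoef (2 * d - n - 2 - (j : ℤ)) ((A.ncoef 2 C.ω ^ j) a) c)

end ConfGVA

/-- A VOA of CFT type: a ℤ-graded conformal vertex algebra with `V = ⊕_{n ∈ ℕ} V_n`,
`dim V_n < ∞`, and `V_0 = K𝟙`. -/
structure VOACFT {K V : Type*} [Field K] [AddCommGroup V] [Module K V] (A : VA K V)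
    extends ConfGVA A where
  gr_neg : ∀ n : ℤ, n < 0 → gr n = ⊥
  gr_fd : ∀ n : ℤ, FiniteDimensional K (gr n)
  gr_zero : gr 0 = Submodule.span K {A.vac}

namespace VOACFT

variable {K V : Type*} [Field K] [AddCommGroup V] [Module K V] {A : VA K V}

abbrev pr (W : VOACFT A) : ℤ → V → V := W.toConfGVA.pr
abbrev ge (W : VOACFT A) : ℤ → Submodule K V := W.toConfGVA.ge
abbrev le (W : VOACFT A) : ℤ → Submodule K V := W.toConfGVA.le
abbrev J1 (W : VOACFT A) : Set V := W.toConfGVA.J1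
abbrev AutPlus (W : VOACFT A) : (V → V) → Prop := W.toConfGVA.AutPlus
abbrev AutMinus (W : VOACFT A) : (V → V) → Prop := W.toConfGVA.AutMinus
abbrev AutZero (W : VOACFT A) : (V → V) → Prop := W.toConfGVA.AutZero
abbrev AutOmega (W : VOACFT A) : (V → V) → Prop := W.toConfGVA.AutOmega
abbrev IsInvForm (W : VOACFT A) : (V →ₗ[K] V →ₗ[K] K) → Prop := W.toConfGVA.IsInvForm

end VOACFT

/-- A VOA of strong CFT type: a VOA of CFT type with `L(1)V_1 = 0`. -/
structure VOAsCFT {K V : Type*} [Field K] [AddCommGroup V] [Module K V] (A : VA K V)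
    extends VOACFT A where
  L1_V1 : ∀ v ∈ gr 1, A.ncoef 2 ω v = 0

namespace VOAsCFT

variable {K V : Type*} [Field K] [AddCommGroup V] [Module K V] {A : VA K V}

abbrev pr (W : VOAsCFT A) : ℤ → V → V := W.toVOACFT.pr
abbrev ge (W : VOAsCFT A) : ℤ → Submodule K V := W.toVOACFT.ge
abbrev le (W : VOAsCFT A) : ℤ → Submodule K V := W.toVOACFT.le
abbrev J1 (W : VOAsCFT A) : Set V := W.toVOACFT.J1
abbrev AutPlus (W : VOAsCFT A) : (V → V) → Prop := W.toVOACFT.AutPlus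
abbrev AutMinus (W : VOAsCFT A) : (V → V) → Prop := W.toVOACFT.AutMinus
abbrev AutZero (W : VOAsCFT A) : (V → V) → Prop := W.toVOACFT.AutZero
abbrev AutOmega (W : VOAsCFT A) : (V → V) → Prop := W.toVOACFT.AutOmega
abbrev IsInvForm (W : VOAsCFT A) : (V →ₗ[K] V →ₗ[K] K) → Prop := W.toVOACFT.IsInvForm

end VOAsCFT

end

namespace GradedVA

variable {K V : Type*} [Field K] [AddCommGroup V] [Module K V] {A : VA K V}

/-- The canonical projection `pr_n` as a linear map. -/
def prLinear (G : GradedVA A) (n : ℤ) : V →ₗ[K] V :=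
  letI := G.decomp
  (G.gr n).subtype ∘ₗ DirectSum.component K ℤ (fun i => G.gr i) n ∘ₗ
    (DirectSum.decomposeLinearEquiv G.gr).toLinearMap

theorem prLinear_mem (G : GradedVA A) (n : ℤ) (v : V) : G.prLinear n v ∈ G.gr n :=
  letI := G.decomp
  (DirectSum.decompose G.gr v n).2

theorem prLinear_of_mem (G : GradedVA A) {n : ℤ} {v : V} (hv : v ∈ G.gr n) :
    G.prLinear n v = v :=
  letI := G.decomp
  DirectSum.decompose_of_mem_same G.gr hv

theorem prLinear_of_mem_ne (G : GradedVA A) {n m : ℤ} {v : V} (hv : v ∈ G.gr n) (h : n ≠ m) :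
    G.prLinear m v = 0 :=
  letI := G.decomp
  DirectSum.decompose_of_mem_ne G.gr hv h

theorem iSup_gr (G : GradedVA A) : ⨆ n, G.gr n = ⊤ :=
  letI := G.decomp
  (DirectSum.Decomposition.isInternal G.gr).submodule_iSup_eq_top

theorem gr_le_ge (G : GradedVA A) {n i : ℤ} (h : n ≤ i) : G.gr i ≤ G.ge n :=
  le_iSup₂_of_le i h le_rfl

theorem ge_antitone (G : GradedVA A) : Antitone G.ge := fun _ _ h =>
  iSup₂_le fun _ hi => G.gr_le_ge (h.trans hi)

theorem ge_le_ge (G G' : GradedVA A) (h : ∀ n, G'.gr n ≤ G.ge n) (n : ℤ) : G'.ge n ≤ G.ge n :=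
  iSup₂_le fun i hi => (h i).trans (G.ge_antitone hi)

/-- A linear map agreeing with another on every homogeneous subspace agrees everywhere. -/
theorem linearMap_ext (G : GradedVA A) {W : Type*} [AddCommGroup W] [Module K W]
    {f g : V →ₗ[K] W} (h : ∀ n, ∀ v ∈ G.gr n, f v = g v) : f = g := by
  refine LinearMap.eqLocus_eq_top.1 (top_le_iff.1 ?_)
  rw [← G.iSup_gr]
  exact iSup_le h

theorem prLinear_eq_zero_of_mem_ge (G : GradedVA A) {n m : ℤ} (h : n < m) {v : V}
    (hv : v ∈ G.ge m) : G.prLinear n v = 0 := by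
  have key : G.ge m ≤ LinearMap.ker (G.prLinear n) :=
    iSup₂_le fun i hi v hv => G.prLinear_of_mem_ne hv (by omega)
  exact key hv

theorem sub_prLinear_mem_ge (G : GradedVA A) {n : ℤ} {v : V} (hv : v ∈ G.ge n) :
    v - G.prLinear n v ∈ G.ge (n + 1) := by
  have key : G.ge n ≤ (G.ge (n + 1)).comap (LinearMap.id - G.prLinear n) := by
    refine iSup₂_le fun i hi v hv => ?_
    rcases hi.eq_or_lt with rfl | hi
    · simp [G.prLinear_of_mem hv]
    · simpa [G.prLinear_of_mem_ne hv hi.ne'] using G.gr_le_ge (by omega) hv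
  exact key hv

/-- On the filtration by `V_{≥n}`, taking leading terms is compatible with products. -/
theorem prLinear_ncoef (G : GradedVA A) {n m : ℤ} (k : ℤ) {a b : V}
    (ha : a ∈ G.ge n) (hb : b ∈ G.ge m) :
    G.prLinear (n + m - k - 1) (A.ncoef k a b)
      = A.ncoef k (G.prLinear n a) (G.prLinear m b) := by
  have homogeneous : ∀ i ≥ n, ∀ x ∈ G.gr i, ∀ j ≥ m, ∀ y ∈ G.gr j,
      G.prLinear (n + m - k - 1) (A.ncoef k x y)
        = A.ncoef k (G.prLinear n x) (G.prLinear m y) := by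
    intro i hi x hx j hj y hy
    have hxy := G.ncoef_mem i j k x hx y hy
    by_cases hin : i = n
    · by_cases hjm : j = m
      · subst hin hjm
        rw [G.prLinear_of_mem hxy, G.prLinear_of_mem hx, G.prLinear_of_mem hy]
      · rw [G.prLinear_of_mem_ne hxy (by omega), G.prLinear_of_mem_ne hy hjm, map_zero]
    · rw [G.prLinear_of_mem_ne hxy (by omega), G.prLinear_of_mem_ne hx hin, map_zero,
        LinearMap.zero_apply]
  have left : ∀ j ≥ m, ∀ b ∈ G.gr j,
      G.ge n ≤ LinearMap.eqLocus (G.prLinear (n + m - k - 1) ∘ₗ (A.ncoef k).flip b)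
        ((A.ncoef k).flip (G.prLinear m b) ∘ₗ G.prLinear n) :=
    fun j hj b hb => iSup₂_le fun i hi a ha => homogeneous i hi a ha j hj b hb
  have right : G.ge m ≤ LinearMap.eqLocus (G.prLinear (n + m - k - 1) ∘ₗ A.ncoef k a)
      (A.ncoef k (G.prLinear n a) ∘ₗ G.prLinear m) :=
    iSup₂_le fun j hj b hb => left j hj b hb ha
  exact right hb

/-- The linear map sending `v ∈ V'_n` to its component `pr_n v ∈ V_n`. -/
def leadingTerm (G G' : GradedVA A) : V →ₗ[K] V :=
  letI := G'.decomp
  DirectSum.toModule K ℤ V (fun n => G.prLinear n ∘ₗ (G'.gr n).subtype) ∘ₗ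
    (DirectSum.decomposeLinearEquiv G'.gr).toLinearMap

theorem leadingTerm_of_mem (G G' : GradedVA A) {n : ℤ} {v : V} (hv : v ∈ G'.gr n) :
    leadingTerm G G' v = G.prLinear n v := by
  let := G'.decomp
  rw [leadingTerm, LinearMap.comp_apply, LinearEquiv.coe_coe,
    DirectSum.decomposeLinearEquiv_apply, DirectSum.decompose_of_mem G'.gr hv,
    ← DirectSum.lof_eq_of K, DirectSum.toModule_lof]
  rfl

theorem leadingTerm_mem (G G' : GradedVA A) {n : ℤ} {v : V} (hv : v ∈ G'.gr n) :
    leadingTerm G G' v ∈ G.gr n := by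
  rw [leadingTerm_of_mem G G' hv]
  exact G.prLinear_mem n v

theorem isVAHom_leadingTerm (G G' : GradedVA A) (h : ∀ n, G'.gr n ≤ G.ge n) :
    A.IsVAHom (leadingTerm G G') where
  map_add := map_add _
  map_smul := map_smul _
  map_vac := by
    rw [leadingTerm_of_mem G G' G'.vac_mem, G.prLinear_of_mem G.vac_mem]
  map_ncoef k a b := by
    have key : (A.ncoef k).compr₂ (leadingTerm G G')
        = (A.ncoef k).compl₁₂ (leadingTerm G G') (leadingTerm G G') := by
      refine G'.linearMap_ext fun n a ha => G'.linearMap_ext fun m b hb => ?_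
      rw [LinearMap.compr₂_apply, LinearMap.compl₁₂_apply,
        leadingTerm_of_mem G G' (G'.ncoef_mem n m k a ha b hb), leadingTerm_of_mem G G' ha,
        leadingTerm_of_mem G G' hb]
      exact G.prLinear_ncoef k (h n ha) (h m hb)
    exact LinearMap.congr_fun₂ key a b

/-- For mutually compatible filtrations, the leading term of the leading term of a
homogeneous vector is the vector itself. -/
theorem prLinear_prLinear (G G' : GradedVA A) (h : ∀ n, G'.gr n ≤ G.ge n)
    (h' : ∀ n, G.gr n ≤ G'.ge n) {n : ℤ} {v : V} (hv : v ∈ G.gr n) :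
    G.prLinear n (G'.prLinear n v) = v := by
  have hz := G.prLinear_eq_zero_of_mem_ge (lt_add_one n)
    (ge_le_ge G G' h _ (G'.sub_prLinear_mem_ge (h' n hv)))
  rw [map_sub, G.prLinear_of_mem hv, sub_eq_zero] at hz
  exact hz.symm

theorem leadingTerm_leadingTerm (G G' : GradedVA A) (h : ∀ n, G'.gr n ≤ G.ge n)
    (h' : ∀ n, G.gr n ≤ G'.ge n) (v : V) :
    leadingTerm G G' (leadingTerm G' G v) = v := by
  have key : leadingTerm G G' ∘ₗ leadingTerm G' G = LinearMap.id := by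
    refine G.linearMap_ext fun n v hv => ?_
    rw [LinearMap.comp_apply, leadingTerm_of_mem G G' (leadingTerm_mem G' G hv),
      leadingTerm_of_mem G' G hv, prLinear_prLinear G G' h h' hv, LinearMap.id_apply]
  exact LinearMap.congr_fun key v

end GradedVA

/-- Lemma `fundamental`: given a second ℤ-grading `G'` on the vertex
algebra with `V'_n ⊆ V_{≥n}` for all `n`, there is a vertex algebra homomorphism
`ψ : V → V` with `ψ(V'_n) ⊆ V_n`; if moreover `V_n ⊆ V'_{≥n}` for all `n`, there is
`ψ ∈ Aut⁺V` with `ψ(V_n) = V'_n` for all `n`. -/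
theorem graded_hom_of_filtration {K V : Type*} [RCLike K] [AddCommGroup V] [Module K V]
    (A : VA K V) (G G' : GradedVA A)
    (h : ∀ n : ℤ, G'.gr n ≤ G.ge n) :
    (∃ ψ : V → V, A.IsVAHom ψ ∧ ∀ n : ℤ, ∀ v ∈ G'.gr n, ψ v ∈ G.gr n) ∧
    ((∀ n : ℤ, G.gr n ≤ G'.ge n) →
      ∃ ψ : V → V, G.AutPlus ψ ∧ ∀ n : ℤ, ψ '' (G.gr n : Set V) = (G'.gr n : Set V)) := by
  refine ⟨⟨GradedVA.leadingTerm G G', GradedVA.isVAHom_leadingTerm G G' h,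
    fun n v hv => GradedVA.leadingTerm_mem G G' hv⟩, fun h' => ?_⟩
  have left_inv := GradedVA.leadingTerm_leadingTerm G G' h h'
  have right_inv := GradedVA.leadingTerm_leadingTerm G' G h' h
  refine ⟨GradedVA.leadingTerm G' G, ⟨⟨GradedVA.isVAHom_leadingTerm G' G h',
    Function.LeftInverse.injective left_inv, Function.RightInverse.surjective right_inv⟩,
    fun n v hv => ⟨h n (GradedVA.leadingTerm_mem G' G hv), ?_⟩⟩, fun n => ?_⟩
  · rw [GradedVA.leadingTerm_of_mem G' G hv]
    exact GradedVA.prLinear_prLinear G G' h h' hv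
  · refine Set.Subset.antisymm ?_ fun v hv =>
      ⟨_, GradedVA.leadingTerm_mem G G' hv, right_inv v⟩
    rintro _ ⟨v, hv, rfl⟩
    exact GradedVA.leadingTerm_mem G' G hv
end

section
/- Let the vector space V carry two direct sum decompositions V = ⊕_{n∈ℤ} V_n and V = ⊕_{n∈ℤ} V'_n. If V'_n ⊆ V_{≥n} and V'_n ∩ V_{≥n+1} = 0 for all n ∈ ℤ, then V_n ⊆ V'_{≥n} for all n ∈ ℤ. -/
/-- If `W' i ≤ ⨆ j ≥ i, W j` and `W' i` meets `⨆ j ≥ i + 1, W j` trivially for all `i`, then an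
element of `W n` lying in `⨆ i ≥ n - k, W' i` already lies in `⨆ i ≥ n, W' i`. -/
theorem mem_iSup_ge_of_mem_iSup_ge_sub {R M : Type*} [Ring R] [AddCommGroup M] [Module R M]
    {W W' : ℤ → Submodule R M}
    (h1 : ∀ n : ℤ, W' n ≤ ⨆ i ≥ n, W i)
    (h2 : ∀ n : ℤ, W' n ⊓ (⨆ i ≥ n + 1, W i) = ⊥)
    {n : ℤ} {x : M} (hx : x ∈ W n) (k : ℕ) (hxk : x ∈ ⨆ i ≥ n - k, W' i) :
    x ∈ ⨆ i ≥ n, W' i := by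
  induction k with
  | zero => simpa using hxk
  | succ k ih =>
    obtain ⟨m, hm⟩ : ∃ m : ℤ, m = n - (k + 1 : ℕ) := ⟨_, rfl⟩
    have hk : n - k = m + 1 := by push_cast at hm; lia
    rw [hk] at ih
    rw [← hm] at hxk
    have hsplit : ⨆ i ≥ m, W' i ≤ W' m ⊔ ⨆ i ≥ m + 1, W' i := by
      refine iSup₂_le fun i hi => ?_
      rcases eq_or_lt_of_le hi with rfl | hi
      · exact le_sup_left
      · exact le_sup_of_le_right (le_iSup₂_of_le i hi le_rfl)
    have hle : ⨆ i ≥ m + 1, W' i ≤ ⨆ i ≥ m + 1, W i :=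
      iSup₂_le fun i hi => (h1 i).trans (biSup_mono fun j hj => le_trans hi hj)
    obtain ⟨a, ha, b, hb, rfl⟩ := Submodule.mem_sup.1 (hsplit hxk)
    have hab : a + b ∈ ⨆ i ≥ m + 1, W i :=
      le_iSup₂ (f := fun i (_ : i ≥ m + 1) => W i) n (by lia) hx
    have ha0 : a ∈ W' m ⊓ ⨆ i ≥ m + 1, W i :=
      ⟨ha, (Submodule.add_mem_iff_left _ (hle hb)).1 hab⟩
    rw [h2, Submodule.mem_bot] at ha0
    subst ha0
    exact ih (by simpa using hb)

/-- Lemma `fil_lem`: for two direct sum decompositions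
`V = ⊕_{n∈ℤ} W_n = ⊕_{n∈ℤ} W'_n` of a vector space, if `W'_n ⊆ W_{≥n}` and
`W'_n ∩ W_{≥n+1} = 0` for all `n`, then `W_n ⊆ W'_{≥n}` for all `n`. -/
theorem le_iSup_of_decompositions {K V : Type*} [Field K] [AddCommGroup V] [Module K V]
    (W W' : ℤ → Submodule K V)
    (hW : DirectSum.IsInternal W) (hW' : DirectSum.IsInternal W')
    (h1 : ∀ n : ℤ, W' n ≤ ⨆ i ≥ n, W i)
    (h2 : ∀ n : ℤ, W' n ⊓ (⨆ i ≥ n + 1, W i) = ⊥) :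
    ∀ n : ℤ, W n ≤ ⨆ i ≥ n, W' i := by
  intro n x hx
  have hdir : Directed (· ≤ ·) fun m : ℤ => ⨆ i ≥ m, W' i :=
    Antitone.directed_le fun a b hab => biSup_mono fun i hi => le_trans hab hi
  have htop : x ∈ ⨆ m : ℤ, ⨆ i ≥ m, W' i := by
    have hle : ⨆ i, W' i ≤ ⨆ m : ℤ, ⨆ i ≥ m, W' i :=
      iSup_mono fun i => le_iSup₂_of_le i le_rfl le_rfl
    exact hle (hW'.submodule_iSup_eq_top ▸ Submodule.mem_top)
  obtain ⟨m, hm⟩ := (Submodule.mem_iSup_of_directed _ hdir).1 htop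
  refine mem_iSup_ge_of_mem_iSup_ge_sub h1 h2 hx (n - m).toNat ?_
  have hmono : ⨆ i ≥ m, W' i ≤ ⨆ i ≥ n - (n - m).toNat, W' i :=
    biSup_mono fun i hi => by lia
  exact hmono hm
end

section
/- Let (V, ω) be a ℤ-graded conformal vertex algebra. If f, g ∈ Aut⁺V satisfy f(ω) = g(ω), then f = g. -/
namespace GradedVA

variable {K V : Type*} [Field K] [AddCommGroup V] [Module K V] {A : VA K V}

theorem pr_sub (G : GradedVA A) (n : ℤ) (u v : V) : G.pr n (u - v) = G.pr n u - G.pr n v := by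
  simp [pr, DirectSum.decompose_sub]

theorem pr_add (G : GradedVA A) (n : ℤ) (u v : V) : G.pr n (u + v) = G.pr n u + G.pr n v := by
  simp [pr, DirectSum.decompose_add]

theorem pr_zero (G : GradedVA A) (n : ℤ) : G.pr n 0 = 0 := by
  simp [pr]

theorem pr_smul (G : GradedVA A) (n : ℤ) (c : K) (v : V) : G.pr n (c • v) = c • G.pr n v := by
  simp only [pr, DirectSum.decompose_smul]
  rfl

theorem pr_mem (G : GradedVA A) (n : ℤ) (v : V) : G.pr n v ∈ G.gr n :=
  SetLike.coe_mem _

theorem pr_of_mem_ne (G : GradedVA A) {n k : ℤ} {v : V} (hv : v ∈ G.gr n) (hnk : n ≠ k) :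
    G.pr k v = 0 :=
  let := G.decomp
  DirectSum.decompose_of_mem_ne G.gr hv hnk

theorem pr_of_mem_same (G : GradedVA A) {n : ℤ} {v : V} (hv : v ∈ G.gr n) : G.pr n v = v :=
  let := G.decomp
  DirectSum.decompose_of_mem_same G.gr hv

theorem eq_of_pr_eq (G : GradedVA A) {u v : V} (h : ∀ n, G.pr n u = G.pr n v) : u = v := by
  let := G.decomp
  apply (DirectSum.decompose G.gr).injective
  ext n
  exact h n

theorem gr_induction (G : GradedVA A) {p : V → Prop} (zero : p 0)
    (mem : ∀ n, ∀ v ∈ G.gr n, p v) (add : ∀ u v, p u → p v → p (u + v)) (v : V) : p v := by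
  let := G.decomp
  exact DirectSum.Decomposition.inductionOn G.gr zero (fun {n} v => mem n v v.2) add v

end GradedVA

namespace ConfGVA

variable {K V : Type*} [Field K] [AddCommGroup V] [Module K V] {A : VA K V}

theorem pr_L0 (C : ConfGVA A) (k : ℤ) (v : V) :
    C.toGradedVA.pr k (A.ncoef 1 C.ω v) = (k : K) • C.toGradedVA.pr k v := by
  induction v using C.gr_induction with
  | zero => simp [GradedVA.pr_zero]
  | mem n v hv =>
    rw [C.L0_grading n v hv, GradedVA.pr_smul]
    by_cases hnk : n = k
    · rw [hnk]
    · simp [C.pr_of_mem_ne hv hnk]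
  | add u v hu hv => rw [map_add, GradedVA.pr_add, GradedVA.pr_add, hu, hv, smul_add]

theorem mem_gr_of_L0_eq [CharZero K] (C : ConfGVA A) {n : ℤ} {v : V}
    (h : A.ncoef 1 C.ω v = (n : K) • v) : v ∈ C.gr n := by
  have key : v = C.toGradedVA.pr n v := by
    refine C.eq_of_pr_eq fun k => ?_
    by_cases hnk : n = k
    · subst hnk
      exact (C.pr_of_mem_same (C.pr_mem n v)).symm
    · rw [C.pr_of_mem_ne (C.pr_mem n v) hnk]
      have hk := C.pr_L0 k v
      rw [h, GradedVA.pr_smul, ← sub_eq_zero, ← sub_smul, smul_eq_zero, sub_eq_zero,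
        Int.cast_inj] at hk
      exact hk.resolve_left hnk
  rw [key]
  exact C.pr_mem n v

end ConfGVA

/-- Lemma `auto_unique`: in a ℤ-graded conformal vertex algebra,
if `f, g ∈ Aut⁺V` satisfy `f(ω) = g(ω)`, then `f = g`. -/
theorem autPlus_eq_of_omega_eq {K V : Type*} [RCLike K] [AddCommGroup V] [Module K V]
    (A : VA K V) (C : ConfGVA A) (f g : V → V)
    (hf : C.AutPlus f) (hg : C.AutPlus g) (h : f C.ω = g C.ω) :
    f = g := by
  obtain ⟨⟨hf, hf_bij⟩, hf_pr⟩ := hf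
  obtain ⟨⟨hg, -⟩, hg_pr⟩ := hg
  funext v
  induction v using C.gr_induction with
  | zero => simpa using (hf.map_smul 0 0).trans (by simpa using (hg.map_smul 0 0).symm)
  | add u v hu hv => rw [hf.map_add, hg.map_add, hu, hv]
  | mem n v hv =>
    obtain ⟨u, hu⟩ := hf_bij.surjective (f v - g v)
    have hu_mem : u ∈ C.gr n := by
      refine C.mem_gr_of_L0_eq (hf_bij.injective ?_)
      rw [hf.map_ncoef, hf.map_smul, hu, map_sub, ← hf.map_ncoef, h, ← hg.map_ncoef,
        C.L0_grading n v hv, hf.map_smul, hg.map_smul, smul_sub]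
    have hu_zero : u = 0 := by
      rw [← (hf_pr n u hu_mem).2, hu, GradedVA.pr_sub, (hf_pr n v hv).2, (hg_pr n v hv).2,
        sub_self]
    have hf_zero : f 0 = 0 := by simpa using hf.map_smul 0 0
    rw [← sub_eq_zero, ← hu, hu_zero, hf_zero]
end

section
/- Let (V, ω) be a ℤ-graded conformal vertex algebra. Assume a ∈ V_{≥2} satisfies: pr_2(a) = ω, a(0) = T, a(1)a = 2a, and a(1) acts semisimply on V with integer eigenvalues. Then there exists a unique ψ_a ∈ Aut⁺V such that ψ_a(ω) = a. In particular, a is a conformal vector of V. -/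
section Decomposition

variable {K V : Type*} [Field K] [AddCommGroup V] [Module K V]

/-- The `n`-th component of a vector with respect to a decomposition of the ambient space. -/
def decompProj {M : ℤ → Submodule K V} (D : DirectSum.Decomposition M) (n : ℤ) : V →ₗ[K] V :=
  letI := D
  (M n).subtype ∘ₗ DirectSum.component K ℤ (fun i => M i) n ∘ₗ
    (DirectSum.decomposeLinearEquiv M).toLinearMap

variable {M : ℤ → Submodule K V} (D : DirectSum.Decomposition M)

theorem decompProj_apply (n : ℤ) (v : V) :
    decompProj D n v = letI := D; (DirectSum.decompose M v n : V) := rfl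

theorem decompProj_mem (n : ℤ) (v : V) : decompProj D n v ∈ M n := by
  rw [decompProj_apply]
  exact SetLike.coe_mem _

theorem decompProj_same {n : ℤ} {v : V} (hv : v ∈ M n) : decompProj D n v = v := by
  let := D
  exact DirectSum.decompose_of_mem_same M hv

theorem decompProj_ne {n m : ℤ} {v : V} (hv : v ∈ M n) (h : n ≠ m) : decompProj D m v = 0 := by
  let := D
  exact DirectSum.decompose_of_mem_ne M hv h

include D in
@[elab_as_elim]
theorem Submodule.decomp_induction {p : V → Prop} (h0 : p 0)
    (hm : ∀ n, ∀ v ∈ M n, p v) (hadd : ∀ u v, p u → p v → p (u + v)) (v : V) : p v := by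
  let := D
  exact DirectSum.Decomposition.inductionOn M h0 (fun {i} m => hm i m m.2) hadd v

theorem exists_finset_decompProj (v : V) :
    ∃ s : Finset ℤ, (∀ i, i ∈ s ↔ decompProj D i v ≠ 0) ∧ ∑ i ∈ s, decompProj D i v = v := by
  classical
  let := D
  refine ⟨(DirectSum.decompose M v).support, fun i => ?_, DirectSum.sum_support_decompose M v⟩
  rw [DFinsupp.mem_support_iff, decompProj_apply]
  simp

theorem mem_iSup_ge_of_decompProj {n : ℤ} {v : V} (h : ∀ i < n, decompProj D i v = 0) :
    v ∈ ⨆ i ≥ n, M i := by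
  obtain ⟨s, hs, hv⟩ := exists_finset_decompProj D v
  rw [← hv]
  refine Submodule.sum_mem _ fun i hi => ?_
  have hin : n ≤ i := by
    by_contra hlt
    exact (hs i).1 hi (h i (by omega))
  exact Submodule.mem_iSup_of_mem i (Submodule.mem_iSup_of_mem hin (decompProj_mem D i v))

theorem decompProj_of_mem_iSup_ge {n : ℤ} {v : V} (hv : v ∈ ⨆ i ≥ n, M i) {j : ℤ} (hj : j < n) :
    decompProj D j v = 0 := by
  have : (⨆ i ≥ n, M i) ≤ LinearMap.ker (decompProj D j) :=
    iSup₂_le fun i hi w hw => decompProj_ne D hw (by omega)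
  exact this hv

theorem exists_lowest_decompProj {v : V} (hv : v ≠ 0) :
    ∃ k, decompProj D k v ≠ 0 ∧ ∀ i < k, decompProj D i v = 0 := by
  obtain ⟨s, hs, hsum⟩ := exists_finset_decompProj D v
  have hne : s.Nonempty := by
    rw [Finset.nonempty_iff_ne_empty]
    rintro rfl
    exact hv (by simpa using hsum.symm)
  refine ⟨s.min' hne, (hs _).1 (s.min'_mem hne), fun i hi => ?_⟩
  by_contra h
  exact absurd (s.min'_le i ((hs i).2 h)) (by omega)

theorem sub_decompProj_mem_iSup_ge {n : ℤ} {v : V} (h : ∀ i < n, decompProj D i v = 0) :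
    v - decompProj D n v ∈ ⨆ i ≥ n + 1, M i := by
  refine mem_iSup_ge_of_decompProj D fun i hi => ?_
  rw [map_sub]
  rcases eq_or_ne i n with rfl | hne
  · rw [decompProj_same D (decompProj_mem D i v), sub_self]
  · rw [h i (by omega), decompProj_ne D (decompProj_mem D n v) hne.symm, sub_zero]

include D in
theorem eq_of_decompProj_eq {u v : V} (h : ∀ i, decompProj D i u = decompProj D i v) : u = v := by
  by_contra hne
  obtain ⟨k, hk, -⟩ := exists_lowest_decompProj D (sub_ne_zero.2 hne)
  exact hk (by rw [map_sub, h k, sub_self])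

end Decomposition

section Modes

variable {K V : Type*} [Field K] [AddCommGroup V] [Module K V]

theorem zBinom_zero_right (m : ℤ) : zBinom K m 0 = 1 := by simp [zBinom]

theorem zBinom_zero_left {i : ℕ} (hi : i ≠ 0) : zBinom K 0 i = 0 := by
  rw [zBinom, Finset.prod_eq_zero (Finset.mem_range.2 (Nat.pos_of_ne_zero hi)) (by simp), zero_div]

theorem zBinom_one_one : zBinom K 1 1 = 1 := by simp [zBinom]

theorem zBinom_one_left {i : ℕ} (hi : 2 ≤ i) : zBinom K 1 i = 0 := by
  rw [zBinom, Finset.prod_eq_zero (Finset.mem_range.2 (by omega : 1 < i)) (by simp), zero_div]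

theorem neg_one_pow_mul_zBinom_neg_two [CharZero K] (i : ℕ) :
    (-1 : K) ^ i * zBinom K (-2) i = (i : K) + 1 := by
  have h : (-1 : K) ^ i * ∏ j ∈ Finset.range i, (((-2 : ℤ) : K) - (j : K))
      = ((i : K) + 1) * (Nat.factorial i : K) := by
    induction i with
    | zero => simp
    | succ n ih =>
      rw [Finset.prod_range_succ, pow_succ, Nat.factorial_succ]
      calc _ = ((-1 : K) ^ n * ∏ j ∈ Finset.range n, (((-2 : ℤ) : K) - (j : K)))
              * ((n : K) + 2) := by push_cast; ring
        _ = _ := by rw [ih]; push_cast; ring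
  rw [zBinom, ← mul_div_assoc, h, mul_div_assoc, div_self, mul_one]
  exact_mod_cast Nat.factorial_ne_zero i

namespace VA

theorem mem_eig {A : VA K V} {a : V} {n : ℤ} {v : V} :
    v ∈ A.eig a n ↔ A.ncoef 1 a v = (n : K) • v := by
  simp [eig, sub_eq_zero]

theorem ncoef_one_ncoef (A : VA K V) (a b c : V) (q : ℤ) :
    A.ncoef 1 a (A.ncoef q b c) = A.ncoef (1 + q) (A.ncoef 0 a b) c
      + A.ncoef q (A.ncoef 1 a b) c + A.ncoef q b (A.ncoef 1 a c) := by
  have h := A.borcherds a b c 0 q 1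
  rw [finsum_eq_sum_of_support_subset (s := Finset.range 2) _ ?_,
    finsum_eq_single _ 0 ?_] at h
  · simp [Finset.sum_range_succ, zBinom_zero_right, zBinom_one_one] at h
    rw [h]
    abel
  · intro i hi
    simp [zBinom_zero_left hi]
  · intro i hi
    rw [Function.mem_support] at hi
    rw [Finset.coe_range, Set.mem_Iio]
    by_contra hlt
    exact hi (by rw [zBinom_one_left (by omega), zero_smul])

theorem ncoef_T [CharZero K] (A : VA K V) (a c : V) (q : ℤ) :
    A.ncoef q (A.T a) c = (-(q : K)) • A.ncoef (q - 1) a c := by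
  have h := A.borcherds a A.vac c (-2) q 0
  rw [finsum_eq_single _ 0 (fun i hi => by rw [zBinom_zero_left hi, zero_smul])] at h
  have hT : A.ncoef (-2) a A.vac = A.T a := rfl
  simp only [zBinom_zero_right, one_smul, Nat.cast_zero, add_zero, sub_zero, zero_add, hT] at h
  rw [h]
  rcases lt_trichotomy q 0 with hq | rfl | hq
  · obtain ⟨k, rfl⟩ : ∃ k : ℕ, q = -(k : ℤ) - 1 := ⟨(-q - 1).toNat, by omega⟩
    rw [finsum_eq_single _ k]
    · rw [neg_one_pow_mul_zBinom_neg_two, A.vac_ncoef, A.vac_ncoef, if_pos (by omega),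
        if_neg (by omega), smul_zero, sub_zero]
      congr 2
      · push_cast; ring
      · congr 1; ring_nf
    · intro i hi
      rw [A.vac_ncoef, A.vac_ncoef, if_neg (by omega), if_neg (by omega)]
      simp
  · rw [finsum_eq_zero_of_forall_eq_zero]
    · simp
    · intro i
      rw [A.vac_ncoef, A.vac_ncoef]
      rcases Nat.eq_zero_or_pos i with rfl | hi
      · simp
      · rw [if_neg (by omega), if_neg (by omega)]
        simp
  · obtain ⟨k, rfl⟩ : ∃ k : ℕ, q = (k : ℤ) + 1 := ⟨(q - 1).toNat, by omega⟩
    have hs : (((-2 : ℤ).negOnePow : ℤ) : K) = 1 := by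
      rw [Int.negOnePow_even _ (by decide)]
      simp
    rw [finsum_eq_single _ k]
    · rw [neg_one_pow_mul_zBinom_neg_two, A.vac_ncoef, A.vac_ncoef, if_neg (by omega),
        if_pos (by omega), hs, map_zero, one_smul, zero_sub, smul_neg, neg_smul]
      congr 2
      · push_cast; ring
      · congr 2; ring_nf
    · intro i hi
      rw [A.vac_ncoef, A.vac_ncoef, if_neg (by omega), if_neg (by omega)]
      simp

theorem ncoef_mem_eig [CharZero K] {A : VA K V} {a : V} (ha0 : A.ncoef 0 a = A.T)
    {n m : ℤ} {u v : V} (hu : u ∈ A.eig a n) (hv : v ∈ A.eig a m) (k : ℤ) :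
    A.ncoef k u v ∈ A.eig a (n + m - k - 1) := by
  rw [mem_eig] at *
  rw [ncoef_one_ncoef, ha0, ncoef_T, hu, hv]
  simp only [map_smul, LinearMap.smul_apply]
  rw [show 1 + k - 1 = k by ring, ← add_smul, ← add_smul]
  congr 1
  push_cast
  ring

theorem vac_mem_eig (A : VA K V) (a : V) : A.vac ∈ A.eig a 0 := by
  rw [mem_eig, A.ncoef_vac_zero 1 (by norm_num)]
  simp

end VA

end Modes

namespace GradedVA

variable {K V : Type*} [Field K] [AddCommGroup V] [Module K V] {A : VA K V} (G : GradedVA A)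

theorem ge_mono {n m : ℤ} (h : n ≤ m) : G.ge m ≤ G.ge n :=
  iSup₂_le fun i hi => le_iSup₂_of_le (f := fun i (_ : i ≥ n) => G.gr i) i (by omega) le_rfl

theorem gr_le_ge_s4 (n : ℤ) : G.gr n ≤ G.ge n :=
  le_iSup₂_of_le (f := fun i (_ : i ≥ n) => G.gr i) n le_rfl le_rfl

theorem ncoef_mem_ge {n m : ℤ} {u v : V} (hu : u ∈ G.ge n) (hv : v ∈ G.ge m) (k : ℤ) :
    A.ncoef k u v ∈ G.ge (n + m - k - 1) := by
  have h1 : ∀ i ≥ n, ∀ x ∈ G.gr i, A.ncoef k x v ∈ G.ge (n + m - k - 1) := by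
    intro i hi x hx
    have : G.ge m ≤ (G.ge (n + m - k - 1)).comap (A.ncoef k x) :=
      iSup₂_le fun j hj y hy =>
        G.ge_mono (by omega) (G.gr_le_ge_s4 _ (G.ncoef_mem i j k x hx y hy))
    exact this hv
  have : G.ge n ≤ (G.ge (n + m - k - 1)).comap ((A.ncoef k).flip v) :=
    iSup₂_le fun i hi x hx => h1 i hi x hx
  exact this hu

theorem decompProj_ncoef {n m : ℤ} {u v : V} (hu : u ∈ G.ge n) (hv : v ∈ G.ge m) (k : ℤ) :
    decompProj G.decomp (n + m - k - 1) (A.ncoef k u v)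
      = A.ncoef k (decompProj G.decomp n u) (decompProj G.decomp m v) := by
  set u₀ := decompProj G.decomp n u with hu₀
  set v₀ := decompProj G.decomp m v with hv₀
  have hu' : u - u₀ ∈ G.ge (n + 1) :=
    sub_decompProj_mem_iSup_ge G.decomp fun i hi => decompProj_of_mem_iSup_ge G.decomp hu hi
  have hv' : v - v₀ ∈ G.ge (m + 1) :=
    sub_decompProj_mem_iSup_ge G.decomp fun i hi => decompProj_of_mem_iSup_ge G.decomp hv hi
  have hu₀' : u₀ ∈ G.gr n := decompProj_mem _ _ _
  have hv₀' : v₀ ∈ G.gr m := decompProj_mem _ _ _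
  have hsplit : A.ncoef k u v
      = A.ncoef k (u - u₀) v + A.ncoef k u₀ (v - v₀) + A.ncoef k u₀ v₀ := by
    simp only [map_sub, LinearMap.sub_apply]
    abel
  rw [hsplit, map_add, map_add,
    decompProj_of_mem_iSup_ge G.decomp (G.ncoef_mem_ge hu' hv k) (by omega),
    decompProj_of_mem_iSup_ge G.decomp (G.ncoef_mem_ge (G.gr_le_ge_s4 _ hu₀') hv' k) (by omega),
    decompProj_same G.decomp (G.ncoef_mem n m k u₀ hu₀' v₀ hv₀'), zero_add, zero_add]

end GradedVA

namespace ConfGVA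

section Eigenvectors

variable {K V : Type*} [Field K] [CharZero K] [AddCommGroup V] [Module K V] {A : VA K V}
  (C : ConfGVA A) {a : V}

theorem lowest_of_mem_eig (ha2 : a ∈ C.ge 2) (hpr : C.pr 2 a = C.ω) {n : ℤ} {v : V}
    (hv : v ∈ A.eig a n) : v ∈ C.ge n ∧ (decompProj C.decomp n v = 0 → v = 0) := by
  rcases eq_or_ne v 0 with rfl | hne
  · exact ⟨Submodule.zero_mem _, fun _ => rfl⟩
  obtain ⟨k, hk, hlow⟩ := exists_lowest_decompProj C.decomp hne
  have hvk : v ∈ C.ge k := mem_iSup_ge_of_decompProj C.decomp hlow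
  have h := C.decompProj_ncoef ha2 hvk 1
  have hpr' : decompProj C.decomp 2 a = C.ω := hpr
  rw [VA.mem_eig.1 hv, map_smul, hpr', C.L0_grading k _ (decompProj_mem _ _ _),
    show 2 + k - 1 - 1 = k by ring, ← sub_eq_zero, ← sub_smul] at h
  have hnk : n = k := by
    have := (smul_eq_zero.1 h).resolve_right hk
    exact_mod_cast sub_eq_zero.1 this
  subst hnk
  exact ⟨hvk, fun h0 => absurd h0 hk⟩

theorem exists_mem_eig_decompProj_eq (ha2 : a ∈ C.ge 2) (hpr : C.pr 2 a = C.ω)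
    (D : DirectSum.Decomposition (A.eig a)) {n : ℤ} {v : V} (hv : v ∈ C.gr n) :
    ∃ w ∈ A.eig a n, decompProj C.decomp n w = v := by
  rcases eq_or_ne v 0 with rfl | hne
  · exact ⟨0, Submodule.zero_mem _, map_zero _⟩
  obtain ⟨k, hk, hlow⟩ := exists_lowest_decompProj D hne
  have hle : (⨆ i ≥ k + 1, A.eig a i) ≤ C.ge (k + 1) :=
    iSup₂_le fun i hi x hx => C.ge_mono hi (C.lowest_of_mem_eig ha2 hpr hx).1
  have h := decompProj_of_mem_iSup_ge C.decomp (hle (sub_decompProj_mem_iSup_ge D hlow))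
    (lt_add_one k)
  rw [map_sub, sub_eq_zero] at h
  have hk' : decompProj C.decomp k (decompProj D k v) ≠ 0 := fun h0 =>
    hk ((C.lowest_of_mem_eig ha2 hpr (decompProj_mem D k v)).2 h0)
  have hnk : n = k := by
    by_contra hnk
    exact hk' (h ▸ decompProj_ne C.decomp hv hnk)
  subst hnk
  exact ⟨_, decompProj_mem D n v, by rw [← h, decompProj_same C.decomp hv]⟩

end Eigenvectors

section Leading

variable {K V : Type*} [Field K] [AddCommGroup V] [Module K V] {A : VA K V}
  (C : ConfGVA A) {a : V}

/-- The linear map sending an `a(1)`-eigenvector of eigenvalue `n` to its degree `n` component. -/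
def leading (D : DirectSum.Decomposition (A.eig a)) : V →ₗ[K] V :=
  letI := D
  DirectSum.toModule K ℤ V (fun n => decompProj C.decomp n ∘ₗ (A.eig a n).subtype) ∘ₗ
    (DirectSum.decomposeLinearEquiv (A.eig a)).toLinearMap

theorem leading_of_mem (D : DirectSum.Decomposition (A.eig a)) {n : ℤ} {v : V}
    (hv : v ∈ A.eig a n) : C.leading D v = decompProj C.decomp n v := by
  let := D
  change DirectSum.toModule K ℤ V _ (DirectSum.decompose (A.eig a) v) = _
  rw [DirectSum.decompose_of_mem _ hv]
  exact DirectSum.toModule_lof K n _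

theorem decompProj_leading (D : DirectSum.Decomposition (A.eig a)) (n : ℤ) (v : V) :
    decompProj C.decomp n (C.leading D v) = decompProj C.decomp n (decompProj D n v) := by
  refine Submodule.decomp_induction D (by simp) (fun m w hw => ?_) (fun u w hu hw => ?_) v
  · rw [C.leading_of_mem D hw]
    rcases eq_or_ne m n with rfl | hne
    · rw [decompProj_same D hw, decompProj_same C.decomp (decompProj_mem _ _ _)]
    · rw [decompProj_ne D hw hne, map_zero, decompProj_ne C.decomp (decompProj_mem _ _ _) hne]
  · simp only [map_add, hu, hw]

variable [CharZero K]

theorem leading_ncoef (ha2 : a ∈ C.ge 2) (hpr : C.pr 2 a = C.ω) (ha0 : A.ncoef 0 a = A.T)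
    (D : DirectSum.Decomposition (A.eig a)) (k : ℤ) (u v : V) :
    C.leading D (A.ncoef k u v) = A.ncoef k (C.leading D u) (C.leading D v) := by
  refine Submodule.decomp_induction D (by simp) (fun n u hu => ?_)
    (fun x y hx hy => by simp only [map_add, LinearMap.add_apply, hx, hy]) u
  refine Submodule.decomp_induction D (by simp) (fun m v hv => ?_)
    (fun x y hx hy => by simp only [map_add, hx, hy]) v
  rw [C.leading_of_mem D hu, C.leading_of_mem D hv,
    C.leading_of_mem D (VA.ncoef_mem_eig ha0 hu hv k),
    C.decompProj_ncoef (C.lowest_of_mem_eig ha2 hpr hu).1 (C.lowest_of_mem_eig ha2 hpr hv).1]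

theorem leading_bijective (ha2 : a ∈ C.ge 2) (hpr : C.pr 2 a = C.ω)
    (D : DirectSum.Decomposition (A.eig a)) : Function.Bijective (C.leading D) := by
  constructor
  · rw [injective_iff_map_eq_zero]
    intro v hv
    refine eq_of_decompProj_eq D fun i => ?_
    rw [map_zero]
    refine (C.lowest_of_mem_eig ha2 hpr (decompProj_mem D i v)).2 ?_
    rw [← C.decompProj_leading D, hv, map_zero]
  · intro v
    refine Submodule.decomp_induction C.decomp ⟨0, map_zero _⟩ (fun n v hv => ?_) ?_ v
    · obtain ⟨w, hw, rfl⟩ := C.exists_mem_eig_decompProj_eq ha2 hpr D hv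
      exact ⟨w, C.leading_of_mem D hw⟩
    · rintro _ _ ⟨x, rfl⟩ ⟨y, rfl⟩
      exact ⟨x + y, map_add _ _ _⟩

end Leading

section Omega

variable {K V : Type*} [Field K] [AddCommGroup V] [Module K V] {A : VA K V} (C : ConfGVA A)

theorem exists_ncoef_omega_omega : ∃ c : K, ∀ n : ℤ, 2 ≤ n →
    A.ncoef n C.ω C.ω = if n = 3 then c • A.vac else 0 := by
  obtain ⟨c, hc⟩ := C.virasoro
  refine ⟨((3 - 1 : ℤ) ^ 3 - (3 - 1 : ℤ) : K) / 12 * c, fun n hn => ?_⟩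
  have h := LinearMap.congr_fun (hc (n - 1) (-2)) A.vac
  simp only [LinearMap.sub_apply, LinearMap.comp_apply, LinearMap.add_apply, LinearMap.smul_apply,
    LinearMap.id_apply] at h
  rw [show n - 1 + 1 = n by ring, show (-2 : ℤ) + 1 = -1 by ring, A.ncoef_vac,
    A.ncoef_vac_zero n (by omega), A.ncoef_vac_zero (n - 1 + -2 + 1) (by omega), map_zero,
    sub_zero, smul_zero, zero_add] at h
  rw [h]
  by_cases h3 : n = 3
  · subst h3
    simp
  · rw [if_neg (by omega), if_neg h3, zero_smul]

end Omega

end ConfGVA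

/-- Theorem `mor`: if `a ∈ V_{≥2}`, `pr_2(a) = ω`, `a(0) = T`,
`a(1)a = 2a`, and `a(1)` is semisimple on `V` with integer eigenvalues
(i.e. `V = ⊕_{n∈ℤ} V_n^a`), then there is a unique `ψ_a ∈ Aut⁺V` with `ψ_a(ω) = a`;
in particular, `a` is a conformal vector. -/
theorem exists_unique_autPlus_of_conformal_data {K V : Type*} [RCLike K]
    [AddCommGroup V] [Module K V]
    (A : VA K V) (C : ConfGVA A) (a : V)
    (ha2 : a ∈ C.ge 2) (hpr : C.pr 2 a = C.ω)
    (ha0 : A.ncoef 0 a = A.T)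
    (ha1 : A.ncoef 1 a a = (2 : K) • a)
    (hss : DirectSum.IsInternal (A.eig a)) :
    (∃! ψ : V → V, C.AutPlus ψ ∧ ψ C.ω = a) ∧ A.IsConformal a := by
  let D : DirectSum.Decomposition (A.eig a) := hss.chooseDecomposition
  let Φ := LinearEquiv.ofBijective (C.leading D) (C.leading_bijective ha2 hpr D)
  have hΦ : ∀ {n : ℤ} {w : V}, w ∈ A.eig a n → Φ.symm (decompProj C.decomp n w) = w :=
    fun hw => Φ.symm_apply_eq.2 (C.leading_of_mem D hw).symm
  have hΦncoef : ∀ (k : ℤ) (u v : V),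
      Φ.symm (A.ncoef k u v) = A.ncoef k (Φ.symm u) (Φ.symm v) := fun k u v => by
    have h := C.leading_ncoef ha2 hpr ha0 D k (Φ.symm u) (Φ.symm v)
    rw [Φ.symm_apply_eq]
    refine Eq.trans ?_ h.symm
    change A.ncoef k u v = A.ncoef k (Φ (Φ.symm u)) (Φ (Φ.symm v))
    rw [Φ.apply_symm_apply, Φ.apply_symm_apply]
  have hvac : Φ.symm A.vac = A.vac := by
    have h := hΦ (A.vac_mem_eig a)
    rwa [decompProj_same C.decomp C.vac_mem] at h
  have hω : Φ.symm C.ω = a := by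
    rw [← hpr]
    exact hΦ (VA.mem_eig.2 (by rw [ha1]; norm_num))
  refine ⟨⟨Φ.symm, ⟨⟨⟨⟨map_add _, map_smul _, hΦncoef, hvac⟩, Φ.symm.bijective⟩, ?_⟩, hω⟩, ?_⟩, ?_⟩
  · intro n v hv
    obtain ⟨w, hw, rfl⟩ := C.exists_mem_eig_decompProj_eq ha2 hpr D hv
    rw [hΦ hw]
    exact ⟨(C.lowest_of_mem_eig ha2 hpr hw).1, rfl⟩
  · rintro φ ⟨⟨⟨hφ, -⟩, hgr⟩, hφω⟩
    funext v
    refine Submodule.decomp_induction C.decomp ?_ (fun n v hv => ?_) (fun x y hx hy => ?_) v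
    · rw [map_zero]
      simpa using hφ.map_smul 0 0
    · have hmem : φ v ∈ A.eig a n := by
        rw [VA.mem_eig, ← hφω, ← hφ.map_ncoef, C.L0_grading n v hv, hφ.map_smul]
      have h := hΦ hmem
      have hp : decompProj C.decomp n (φ v) = v := (hgr n v hv).2
      rw [hp] at h
      exact h.symm
    · rw [hφ.map_add, map_add, hx, hy]
  · obtain ⟨c, hc⟩ := C.exists_ncoef_omega_omega
    have hmode : ∀ n : ℤ, A.ncoef n a a = Φ.symm (A.ncoef n C.ω C.ω) := fun n => by
      rw [hΦncoef, hω]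
    refine ⟨ha1, ⟨c, ?_⟩, ?_, fun n hn => ?_, ha0, hss⟩
    · rw [hmode, hc 3 (by norm_num), if_pos rfl, map_smul, hvac]
    · rw [hmode, hc 2 le_rfl, if_neg (by norm_num), map_zero]
    · rw [hmode, hc n (by omega), if_neg (by omega), map_zero]
end
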